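/- arXiv:1810.04298 — 4 statements merged into one kernel-verified Lean document; each statement's English description precedes it below -/
import Mathlib

section
/- Let q be a prime and let L ∈ 𝔽_q^{k×k} be an invertible lower-triangular matrix that is not diagonal. Then there exists a nonzero α ∈ 𝔽_q such that L contains the matrix H = [[1,0],[α,1]] ∈ 𝔽_q^{2×2} in a useful way, i.e. H ⊑_u L. -/
/- `UsefulContains R M` : `M` contains `R` in a useful way (`R ⊑_u M`): there are a
permutation matrix `P` (given by the row permutation `σ`) and `T ∈ 𝔽_q^{k×m}` with
`P M T = [R ; 0]`, and the last nonzero row of `T` (row `j₀`) equals `α·e_m`, `α ≠ 0`. -/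
def UsefulContains {q k m : ℕ} (R : Matrix (Fin m) (Fin m) (ZMod q))
    (M : Matrix (Fin k) (Fin k) (ZMod q)) : Prop :=
  ∃ (T : Matrix (Fin k) (Fin m) (ZMod q)) (σ : Equiv.Perm (Fin k)) (j₀ : Fin k) (α : ZMod q),
    α ≠ 0 ∧
    (∀ (i : Fin k) (j : Fin m),
      (M.submatrix σ id * T) i j = if h : (i : ℕ) < m then R ⟨(i : ℕ), h⟩ j else 0) ∧
    (∀ i : Fin k, j₀ < i → ∀ j : Fin m, T i j = 0) ∧
    (∀ j : Fin m, T j₀ j = if (j : ℕ) = m - 1 then α else 0)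

/-- Two distinct points can be sent to any two distinct points by a permutation. -/
theorem exists_perm_apply_eq_pair {α : Type*} [DecidableEq α] {x y a b : α} (hxy : x ≠ y)
    (hab : a ≠ b) : ∃ σ : Equiv.Perm α, σ x = a ∧ σ y = b := by
  refine ⟨Equiv.swap (Equiv.swap x a y) b * Equiv.swap x a, ?_, ?_⟩
  · rw [Equiv.Perm.mul_apply, Equiv.swap_apply_left]
    refine Equiv.swap_apply_of_ne_of_ne (fun h => hxy ?_) hab
    exact (Equiv.swap x a).injective (by rw [Equiv.swap_apply_left, ← h])
  · rw [Equiv.Perm.mul_apply, Equiv.swap_apply_left]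

/-- every invertible lower-triangular non-diagonal matrix contains
`H = [[1,0],[α,1]]` (for some `α ≠ 0`) in a useful way. -/
theorem stmt7 (q : ℕ) (hq : Nat.Prime q) {k : ℕ}
    (L : Matrix (Fin k) (Fin k) (ZMod q))
    (hlower : ∀ i j : Fin k, i < j → L i j = 0)
    (hinv : IsUnit L.det)
    (hnotdiag : ∃ i j : Fin k, i ≠ j ∧ L i j ≠ 0) :
    ∃ α : ZMod q, α ≠ 0 ∧
      UsefulContains (!![1, 0; α, 1] : Matrix (Fin 2) (Fin 2) (ZMod q)) L := by
  classical
  have : Fact q.Prime := ⟨hq⟩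
  have hLinv : L * L⁻¹ = 1 := Matrix.mul_nonsing_inv L hinv
  have hLtri : L.BlockTriangular OrderDual.toDual := fun i j h => hlower i j h
  let _ : Invertible L := L.invertibleOfIsUnitDet hinv
  have hNtri : L⁻¹.BlockTriangular OrderDual.toDual :=
    Matrix.blockTriangular_inv_of_blockTriangular hLtri
  have hNdiag : ∀ r, L⁻¹ r r ≠ 0 := by
    intro r h0
    have hdet : L⁻¹.det ≠ 0 := (Matrix.isUnit_nonsing_inv_det L hinv).ne_zero
    rw [Matrix.det_of_isLowerTriangular _ hNtri] at hdet
    exact hdet (Finset.prod_eq_zero (Finset.mem_univ r) h0)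
  have hNoff : ∃ r a, a ≠ r ∧ L⁻¹ r a ≠ 0 := by
    by_contra! h
    obtain ⟨i, j, hij, hne⟩ := hnotdiag
    have hentry : (L * L⁻¹) i j = L i j * L⁻¹ j j := by
      rw [Matrix.mul_apply]
      refine Finset.sum_eq_single j (fun l _ hl => ?_) (by simp)
      rw [h l j hl.symm, mul_zero]
    rw [hLinv, Matrix.one_apply_ne hij] at hentry
    exact mul_ne_zero hne (hNdiag j) hentry.symm
  obtain ⟨r, ⟨a, har, hra⟩, hmax⟩ :=
    (Set.toFinite {r | ∃ a, a ≠ r ∧ L⁻¹ r a ≠ 0}).exists_maximal hNoff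
  have hbelow : ∀ i, r < i → ∀ c, c ≠ i → L⁻¹ i c = 0 := fun i hi c hc => by
    by_contra hne
    exact absurd (hmax ⟨c, hc, hne⟩ hi.le) (not_le.mpr hi)
  have hk : 1 < k := by
    have := Fin.val_ne_of_ne har
    omega
  obtain ⟨σ, hσ0, hσ1⟩ := exists_perm_apply_eq_pair
    (x := (⟨0, by omega⟩ : Fin k)) (y := ⟨1, hk⟩) (by simp) har
  set β : ZMod q := -(L⁻¹ r a / L⁻¹ r r) with hβ
  let V : Matrix (Fin k) (Fin 2) (ZMod q) :=
    Matrix.of fun i => ![(if i = a then 1 else 0) + β * (if i = r then 1 else 0), if i = r then 1 else 0]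
  have hT : ∀ i, (L⁻¹ * V) i 0 = L⁻¹ i a + β * L⁻¹ i r ∧ (L⁻¹ * V) i 1 = L⁻¹ i r := by
    intro i
    simp [V, Matrix.mul_apply, mul_add, Finset.sum_add_distrib, mul_comm]
  refine ⟨β, neg_ne_zero.mpr (div_ne_zero hra (hNdiag r)), L⁻¹ * V, σ, r, L⁻¹ r r, hNdiag r,
    ?_, ?_, ?_⟩
  · intro i j
    have hmul : (L.submatrix σ id * (L⁻¹ * V)) i j = V (σ i) j := by
      change (L * (L⁻¹ * V)) (σ i) j = V (σ i) j
      rw [← Matrix.mul_assoc, hLinv, Matrix.one_mul]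
    rw [hmul]
    have hia : σ i = a ↔ (i : ℕ) = 0 := by rw [← hσ0, σ.injective.eq_iff, Fin.ext_iff]
    have hir : σ i = r ↔ (i : ℕ) = 1 := by rw [← hσ1, σ.injective.eq_iff, Fin.ext_iff]
    obtain ⟨n, hn⟩ := i
    rcases n with _ | _ | n <;> fin_cases j <;> simp [V, hia, hir]
  · intro i hi
    have ha : L⁻¹ i a = 0 := by
      refine hbelow i hi a fun hai => ?_
      subst hai
      exact hra (hNtri hi)
    refine Fin.forall_fin_two.mpr ⟨?_, ?_⟩
    · rw [(hT i).1, ha, hbelow i hi r hi.ne, mul_zero, add_zero]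
    · rw [(hT i).2, hbelow i hi r hi.ne]
  · refine Fin.forall_fin_two.mpr ⟨?_, ?_⟩
    · rw [(hT r).1, hβ, neg_mul, div_mul_cancel₀ _ (hNdiag r), add_neg_cancel]
      simp
    · rw [(hT r).2]
      simp
end

section
/- Let q be a prime, α ∈ 𝔽_q nonzero, and suppose a matrix M ∈ 𝔽_q^{k×k} contains R = ([[1,0],[α,1]])⊗([[1,0],[α,1]]) ∈ 𝔽_q^{4×4} in a useful way (R ⊑_u M). Then for every ε > 0, M satisfies (1/k, 2-ε)-exponential polarization. -/
open scoped BigOperators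

/- Probability of an event under a probability mass function on a finite type. -/
open Classical in
noncomputable def pmfProb {Ω : Type} [Fintype Ω] (μ : Ω → ℝ) (S : Set Ω) : ℝ :=
  ∑ ω : Ω, if ω ∈ S then μ ω else 0

/- Conditional Shannon entropy (base 2) `H(X|Y)` of finitely-valued random variables
on a finite probability space given by the mass function `μ`. -/
open Classical in
noncomputable def condEnt {Ω S T : Type} [Fintype Ω] [Fintype S] [Fintype T]
    (μ : Ω → ℝ) (X : Ω → S) (Y : Ω → T) : ℝ :=
  ∑ s : S, ∑ t : T,
    (if pmfProb μ {ω | X ω = s ∧ Y ω = t} = 0 then 0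
     else -(pmfProb μ {ω | X ω = s ∧ Y ω = t}) *
        Real.logb 2 (pmfProb μ {ω | X ω = s ∧ Y ω = t} / pmfProb μ {ω | Y ω = t}))

/- Normalized conditional entropy `H̄(X|Y) = H(X|Y)/log₂ q` for `X` valued in `𝔽_q`. -/
noncomputable def nCondEnt (q : ℕ) [NeZero q] {Ω T : Type} [Fintype Ω] [Fintype T]
    (μ : Ω → ℝ) (X : Ω → ZMod q) (Y : Ω → T) : ℝ :=
  condEnt μ X Y / Real.logb 2 q

/- A matrix `M ∈ 𝔽_q^{k×k}` satisfies `(η, b)`-exponential polarization. -/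
open Classical in
noncomputable def ExpPolar (q : ℕ) [NeZero q] (k : ℕ)
    (M : Matrix (Fin k) (Fin k) (ZMod q)) (η b : ℝ) : Prop :=
  ∃ τ : ℝ, 0 < τ ∧ ∀ δ : ℝ, 0 ≤ δ → δ < τ →
    ∀ (Ω Alph : Type) [Fintype Ω] [Fintype Alph] (μ : Ω → ℝ),
      (∀ ω, 0 ≤ μ ω) → (∑ ω : Ω, μ ω = 1) →
      ∀ (U : Fin k → Ω → ZMod q) (A : Fin k → Ω → Alph),
      -- the pairs (U_i, A_i) are i.i.d. with common marginal p
      (∃ p : ZMod q × Alph → ℝ,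
        (∀ (i : Fin k) (u : ZMod q) (a : Alph),
            pmfProb μ {ω | U i ω = u ∧ A i ω = a} = p (u, a)) ∧
        (∀ (u : Fin k → ZMod q) (a : Fin k → Alph),
            pmfProb μ {ω | ∀ i, U i ω = u i ∧ A i ω = a i} = ∏ i, p (u i, a i))) →
      (∀ i : Fin k, nCondEnt q μ (U i) (A i) ≤ δ) →
      η * k ≤ ((Finset.univ : Finset (Fin k)).filter (fun j : Fin k =>
        nCondEnt q μ (fun ω => Matrix.vecMul (fun i => U i ω) M j)
          (fun ω => ((fun i : Fin (j : ℕ) =>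
              Matrix.vecMul (fun i' => U i' ω) M (Fin.castLE j.isLt.le i)),
            (fun i => A i ω))) ≤ δ ^ b)).card

/- A matrix is mixing if it is invertible and no row permutation of it is upper triangular. -/
def IsMixing {q k : ℕ} (M : Matrix (Fin k) (Fin k) (ZMod q)) : Prop :=
  IsUnit M.det ∧ ∀ σ : Equiv.Perm (Fin k), ¬ (∀ i j : Fin k, j < i → M (σ i) j = 0)

/- The Kronecker square `M ⊗ M`, with the standard (lexicographic) indexing by `Fin (k*k)`. -/
noncomputable def kron2 {q k : ℕ} (M : Matrix (Fin k) (Fin k) (ZMod q)) :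
    Matrix (Fin (k * k)) (Fin (k * k)) (ZMod q) :=
  Matrix.reindex finProdFinEquiv finProdFinEquiv (Matrix.kroneckerMap (· * ·) M M)

lemma pmfProb_eq_sum {Ω : Type} [Fintype Ω] (μ : Ω → ℝ) (p : Ω → Prop) [DecidablePred p] :
    pmfProb μ {ω | p ω} = ∑ ω : Ω, μ ω * (if p ω then 1 else 0) := by
  refine Finset.sum_congr rfl fun ω _ => ?_
  by_cases h : p ω <;> simp [h]

lemma pmfProb_nonneg {Ω : Type} [Fintype Ω] {μ : Ω → ℝ} (hμ : ∀ ω, 0 ≤ μ ω) (S : Set Ω) :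
    0 ≤ pmfProb μ S := by
  classical
  exact Finset.sum_nonneg fun ω _ => by split_ifs <;> simp [hμ]

lemma pmfProb_mono {Ω : Type} [Fintype Ω] {μ : Ω → ℝ} (hμ : ∀ ω, 0 ≤ μ ω) {S S' : Set Ω}
    (h : S ⊆ S') : pmfProb μ S ≤ pmfProb μ S' := by
  classical
  refine Finset.sum_le_sum fun ω _ => ?_
  by_cases h1 : ω ∈ S
  · simp [h1, h h1]
  · by_cases h2 : ω ∈ S' <;> simp [h1, h2, hμ]

lemma pmfProb_union_le {Ω : Type} [Fintype Ω] {μ : Ω → ℝ} (hμ : ∀ ω, 0 ≤ μ ω) (S S' : Set Ω) :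
    pmfProb μ (S ∪ S') ≤ pmfProb μ S + pmfProb μ S' := by
  classical
  unfold pmfProb
  rw [← Finset.sum_add_distrib]
  refine Finset.sum_le_sum fun ω _ => ?_
  by_cases h1 : ω ∈ S <;> by_cases h2 : ω ∈ S' <;> simp [h1, h2, hμ]

/-- Change of variables for a finitely-valued random variable. -/
lemma sum_mul_pmfProb {Ω Z : Type} [Fintype Ω] [Fintype Z] (μ : Ω → ℝ) (X : Ω → Z) (F : Z → ℝ) :
    ∑ z, F z * pmfProb μ {ω | X ω = z} = ∑ ω, μ ω * F (X ω) := by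
  classical
  simp only [pmfProb, Finset.mul_sum, Set.mem_ofPred_eq]
  rw [Finset.sum_comm]
  refine Finset.sum_congr rfl fun ω _ => ?_
  simp [mul_comm]

lemma sum_mul_pmfProb_pair {Ω S T : Type} [Fintype Ω] [Fintype S] [Fintype T] (μ : Ω → ℝ)
    (X : Ω → S) (Y : Ω → T) (F : S → T → ℝ) :
    ∑ s, ∑ t, F s t * pmfProb μ {ω | X ω = s ∧ Y ω = t} = ∑ ω, μ ω * F (X ω) (Y ω) := by
  have := sum_mul_pmfProb μ (fun ω => (X ω, Y ω)) (fun z => F z.1 z.2)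
  simpa [Fintype.sum_prod_type, Prod.mk.injEq] using this

lemma sum_pmfProb_left {Ω S T : Type} [Fintype Ω] [Fintype S] (μ : Ω → ℝ)
    (X : Ω → S) (Y : Ω → T) (t : T) :
    ∑ s, pmfProb μ {ω | X ω = s ∧ Y ω = t} = pmfProb μ {ω | Y ω = t} := by
  classical
  simp only [pmfProb, Set.mem_ofPred_eq]
  rw [Finset.sum_comm]
  refine Finset.sum_congr rfl fun ω _ => ?_
  by_cases h : Y ω = t <;> simp [h]

/-- A Fano-type inequality: a good estimator of `X` from `Y` makes `H(X|Y)` small. -/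
lemma condEnt_mul_log_two_le {Ω S T : Type} [Fintype Ω] [Fintype S] [Fintype T] {μ : Ω → ℝ}
    (hμ : ∀ ω, 0 ≤ μ ω) (hμ1 : ∑ ω, μ ω = 1) (X : Ω → S) (Y : Ω → T) (g : T → S)
    {r : ℝ} (hr : 0 < r) :
    condEnt μ X Y * Real.log 2 ≤ pmfProb μ {ω | X ω ≠ g (Y ω)} + r * Fintype.card S
      + pmfProb μ {ω | X ω ≠ g (Y ω)} * (-Real.log r) := by
  classical
  have hlog2 : 0 < Real.log 2 := Real.log_pos (by norm_num)
  have key : ∀ s t,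
      (if pmfProb μ {ω | X ω = s ∧ Y ω = t} = 0 then 0
       else -(pmfProb μ {ω | X ω = s ∧ Y ω = t}) *
        Real.logb 2 (pmfProb μ {ω | X ω = s ∧ Y ω = t} / pmfProb μ {ω | Y ω = t})) * Real.log 2
      ≤ (if s = g t then 1 else 0) * pmfProb μ {ω | Y ω = t}
        - (if s = g t then 1 else 0) * pmfProb μ {ω | X ω = s ∧ Y ω = t}
        + r * pmfProb μ {ω | Y ω = t}
        + ((if s ≠ g t then 1 else 0) * pmfProb μ {ω | X ω = s ∧ Y ω = t}) * (-Real.log r) := by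
    intro s t
    have hP0 := pmfProb_nonneg hμ {ω | X ω = s ∧ Y ω = t}
    have hPQ : pmfProb μ {ω | X ω = s ∧ Y ω = t} ≤ pmfProb μ {ω | Y ω = t} :=
      pmfProb_mono hμ fun ω h => h.2
    generalize pmfProb μ {ω | X ω = s ∧ Y ω = t} = P at *
    generalize pmfProb μ {ω | Y ω = t} = Q at *
    have hrQ : 0 ≤ r * Q := mul_nonneg hr.le (hP0.trans hPQ)
    by_cases hP : P = 0
    · subst hP
      by_cases h : s = g t <;> simp [h] <;> linarith
    have hPpos : 0 < P := lt_of_le_of_ne hP0 (Ne.symm hP)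
    have hQpos : 0 < Q := hPpos.trans_le hPQ
    have e1 : -P * Real.logb 2 (P / Q) * Real.log 2 = P * Real.log (Q / P) := by
      rw [Real.logb, Real.log_div hP hQpos.ne', Real.log_div hQpos.ne' hP]
      field_simp
      ring
    rw [if_neg hP, e1]
    by_cases h : s = g t
    · have h1 := Real.log_le_sub_one_of_pos (div_pos hQpos hPpos)
      have h2 := mul_le_mul_of_nonneg_left h1 hP0
      have h3 : P * (Q / P - 1) = Q - P := by field_simp
      simp [h]
      linarith
    · have h1 := Real.log_le_sub_one_of_pos (div_pos (mul_pos hr hQpos) hPpos)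
      rw [mul_div_assoc, Real.log_mul hr.ne' (div_pos hQpos hPpos).ne'] at h1
      have h2 := mul_le_mul_of_nonneg_left h1 hP0
      have h3 : P * (r * (Q / P) - 1) = r * Q - P := by field_simp
      simp [h]
      linarith
  have hsum : ∑ s, ∑ t, ((if s = g t then 1 else 0) * pmfProb μ {ω | Y ω = t}
        - (if s = g t then 1 else 0) * pmfProb μ {ω | X ω = s ∧ Y ω = t}
        + r * pmfProb μ {ω | Y ω = t}
        + ((if s ≠ g t then 1 else 0) * pmfProb μ {ω | X ω = s ∧ Y ω = t}) * (-Real.log r))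
      = pmfProb μ {ω | X ω ≠ g (Y ω)} + r * Fintype.card S
      + pmfProb μ {ω | X ω ≠ g (Y ω)} * (-Real.log r) := by
    have hY : ∑ t, pmfProb μ {ω | Y ω = t} = 1 := by
      simpa [hμ1] using sum_mul_pmfProb μ Y (fun _ => (1 : ℝ))
    have a1 : ∑ s, ∑ t, (if s = g t then (1 : ℝ) else 0) * pmfProb μ {ω | Y ω = t} = 1 := by
      rw [Finset.sum_comm]
      simpa using hY
    have a2 := sum_mul_pmfProb_pair μ X Y (fun s t => if s = g t then (1 : ℝ) else 0)
    have a3 := sum_mul_pmfProb_pair μ X Y (fun s t => if s ≠ g t then (1 : ℝ) else 0)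
    have a4 : pmfProb μ {ω | X ω ≠ g (Y ω)} = 1 - ∑ ω, μ ω * (if X ω = g (Y ω) then 1 else 0) := by
      rw [eq_sub_iff_add_eq, pmfProb_eq_sum, ← Finset.sum_add_distrib]
      refine (Finset.sum_congr rfl fun ω _ => ?_).trans hμ1
      by_cases h : X ω = g (Y ω) <;> simp [h]
    have a5 : pmfProb μ {ω | X ω ≠ g (Y ω)} = ∑ ω, μ ω * (if X ω ≠ g (Y ω) then 1 else 0) := by
      rw [pmfProb_eq_sum]
    have a6 : ∑ s : S, ∑ t, r * pmfProb μ {ω | Y ω = t} = r * Fintype.card S := by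
      simp [← Finset.mul_sum, hY, mul_comm]
    simp only [Finset.sum_add_distrib, Finset.sum_sub_distrib, ← Finset.sum_mul]
    rw [a1, a2, a3, a6, ← a5]
    linarith
  rw [← hsum, condEnt, Finset.sum_mul]
  refine Finset.sum_le_sum fun s _ => ?_
  rw [Finset.sum_mul]
  exact Finset.sum_le_sum fun t _ => key s t

/-- The maximum a posteriori estimator errs with probability at most `H(X|Y)`. -/
lemma exists_estimator {Ω S T : Type} [Fintype Ω] [Fintype S] [Nonempty S] [Fintype T] {μ : Ω → ℝ}
    (hμ : ∀ ω, 0 ≤ μ ω) (X : Ω → S) (Y : Ω → T) :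
    ∃ g : T → S, pmfProb μ {ω | X ω ≠ g (Y ω)} ≤ condEnt μ X Y := by
  classical
  have hmax : ∀ t, ∃ s, ∀ s', pmfProb μ {ω | X ω = s' ∧ Y ω = t}
      ≤ pmfProb μ {ω | X ω = s ∧ Y ω = t} := fun t =>
    Finite.exists_max fun s => pmfProb μ {ω | X ω = s ∧ Y ω = t}
  choose g hg using hmax
  refine ⟨g, ?_⟩
  have a3 := sum_mul_pmfProb_pair μ X Y (fun s t => if s ≠ g t then (1 : ℝ) else 0)
  have a5 : pmfProb μ {ω | X ω ≠ g (Y ω)} = ∑ ω, μ ω * (if X ω ≠ g (Y ω) then 1 else 0) := by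
    rw [pmfProb_eq_sum]
  rw [a5, ← a3, condEnt, Finset.sum_comm, Finset.sum_comm (s := (Finset.univ : Finset S))]
  refine Finset.sum_le_sum fun t _ => ?_
  have hQ := sum_pmfProb_left μ X Y t
  have hP0 : ∀ s, 0 ≤ pmfProb μ {ω | X ω = s ∧ Y ω = t} := fun s => pmfProb_nonneg hμ _
  have hPQ : ∀ s, pmfProb μ {ω | X ω = s ∧ Y ω = t} ≤ pmfProb μ {ω | Y ω = t} := fun s =>
    pmfProb_mono hμ fun ω h => h.2
  have hm := hg t
  generalize pmfProb μ {ω | Y ω = t} = Q at *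
  generalize hP : (fun s => pmfProb μ {ω | X ω = s ∧ Y ω = t}) = P
  have hP' : ∀ s, pmfProb μ {ω | X ω = s ∧ Y ω = t} = P s := fun s => congrFun hP s
  simp only [hP'] at *
  have hlog2 : 0 < Real.log 2 := Real.log_pos (by norm_num)
  have hlog2' : Real.log 2 ≤ 1 := by linarith [Real.log_two_lt_d9]
  have key : ∀ s, P s - P s * (P (g t) / Q)
      ≤ if P s = 0 then 0 else -(P s) * Real.logb 2 (P s / Q) := by
    intro s
    by_cases h0 : P s = 0
    · simp [h0]
    have hPpos : 0 < P s := lt_of_le_of_ne (hP0 s) (Ne.symm h0)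
    have hQpos : 0 < Q := hPpos.trans_le (hPQ s)
    have hle : P s / Q ≤ 1 := (div_le_one hQpos).2 (hPQ s)
    have hpos : 0 < P s / Q := div_pos hPpos hQpos
    have h1 : 1 - P (g t) / Q ≤ -Real.log (P s / Q) := by
      have := Real.log_le_sub_one_of_pos hpos
      have : P s / Q ≤ P (g t) / Q := div_le_div_of_nonneg_right (hm s) hQpos.le
      linarith
    have h2 : -Real.log (P s / Q) ≤ -Real.logb 2 (P s / Q) := by
      rw [Real.logb, ← neg_div, le_div_iff₀ hlog2]
      have : 0 ≤ -Real.log (P s / Q) := by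
        linarith [Real.log_nonpos hpos.le hle]
      nlinarith
    rw [if_neg h0]
    have := mul_le_mul_of_nonneg_left (h1.trans h2) (hP0 s)
    linarith
  refine le_trans ?_ (Finset.sum_le_sum fun s _ => key s)
  rw [Finset.sum_sub_distrib, ← Finset.sum_mul, hQ]
  have e : ∑ s, (if s ≠ g t then (1 : ℝ) else 0) * P s = Q - P (g t) := by
    have h3 : ∑ s, (if s = g t then (1 : ℝ) else 0) * P s = P (g t) := by simp
    rw [← hQ, ← h3, ← Finset.sum_sub_distrib]
    refine Finset.sum_congr rfl fun s _ => ?_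
    by_cases h : s = g t <;> simp [h]
  rw [e]
  by_cases hQ0 : Q = 0
  · have := hP0 (g t)
    simp [hQ0, this]
  · rw [mul_div_cancel₀ _ hQ0]

/-- Events about two different coordinates of an i.i.d. sequence are independent. -/
lemma pmfProb_inter_of_iid {Ω Z : Type} [Fintype Ω] [Fintype Z] {μ : Ω → ℝ}
    (hμ1 : ∑ ω, μ ω = 1) {k : ℕ} (V : Fin k → Ω → Z) (p : Z → ℝ)
    (hm : ∀ i z, pmfProb μ {ω | V i ω = z} = p z)
    (hj : ∀ z : Fin k → Z, pmfProb μ {ω | ∀ i, V i ω = z i} = ∏ i, p (z i))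
    (B C : Z → Prop) {i j : Fin k} (hij : i ≠ j) :
    pmfProb μ {ω | B (V i ω) ∧ C (V j ω)}
      = pmfProb μ {ω | B (V i ω)} * pmfProb μ {ω | C (V j ω)} := by
  classical
  set f : Fin k → Z → ℝ := fun l z =>
    if l = i then (if B z then 1 else 0) else if l = j then (if C z then 1 else 0) else 1 with hf
  have hprod : ∀ z : Fin k → Z, ∏ l, f l (z l) = if B (z i) ∧ C (z j) then 1 else 0 := by
    intro z
    rw [Fintype.prod_eq_mul i j hij fun l hl => by simp [hf, hl.1, hl.2]]
    by_cases h1 : B (z i) <;> by_cases h2 : C (z j) <;> simp [hf, hij.symm, h1, h2]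
  have hone : ∀ l, ∑ z, f l z * p z = ∑ ω, μ ω * f l (V l ω) := by
    intro l
    rw [← sum_mul_pmfProb μ (V l) (f l)]
    simp only [hm]
  calc pmfProb μ {ω | B (V i ω) ∧ C (V j ω)}
      = ∑ ω, μ ω * ∏ l, f l (V l ω) := by
        rw [pmfProb_eq_sum]
        exact Finset.sum_congr rfl fun ω _ => by rw [hprod fun l => V l ω]
    _ = ∑ z : Fin k → Z, (∏ l, f l (z l)) * ∏ l, p (z l) := by
        rw [← sum_mul_pmfProb μ (fun ω l => V l ω) (fun z => ∏ l, f l (z l))]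
        refine Finset.sum_congr rfl fun z _ => ?_
        rw [← hj z]
        simp only [funext_iff]
    _ = ∏ l, ∑ z, f l z * p z := by
        simp only [← Finset.prod_mul_distrib]
        rw [Finset.prod_univ_sum]
        simp
    _ = ∏ l, ∑ ω, μ ω * f l (V l ω) := Finset.prod_congr rfl fun l _ => hone l
    _ = _ := by
        rw [Fintype.prod_eq_mul i j hij fun l hl => by simp [hf, hl.1, hl.2, hμ1],
          pmfProb_eq_sum, pmfProb_eq_sum]
        simp [hf, hij.symm]

/-- A sum over `Fin k` whose terms vanish beyond `j`. -/
lemma sum_eq_sum_castLE_add {R : Type*} [AddCommMonoid R] {k : ℕ} (j : Fin k) (F : Fin k → R)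
    (h : ∀ i, j < i → F i = 0) :
    ∑ i, F i = ∑ i : Fin (j : ℕ), F (Fin.castLE j.isLt.le i) + F j := by
  obtain ⟨j, hj⟩ := j
  obtain ⟨m, rfl⟩ : ∃ m, k = j + 1 + m := Nat.exists_eq_add_of_le hj
  rw [Fin.sum_univ_add, Fin.sum_univ_castSucc]
  have h0 : ∑ i : Fin m, F (Fin.natAdd (j + 1) i) = 0 :=
    Finset.sum_eq_zero fun i _ => h _ (by simp [Fin.lt_def]; omega)
  rw [h0, add_zero]
  rfl

/-- Multiplying `uM` by `T` only involves the rows of `M T`, in any order. -/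
lemma sum_vecMul_mul {q k m : ℕ} (M : Matrix (Fin k) (Fin k) (ZMod q))
    (T : Matrix (Fin k) (Fin m) (ZMod q)) (σ : Equiv.Perm (Fin k)) (u : Fin k → ZMod q)
    (j : Fin m) :
    ∑ l, Matrix.vecMul u M l * T l j = ∑ i, u (σ i) * (M.submatrix σ id * T) i j := by
  have h1 : ∑ l, Matrix.vecMul u M l * T l j = Matrix.vecMul u (M * T) j := by
    rw [← Matrix.vecMul_vecMul]; rfl
  have h2 : ∀ i, (M.submatrix σ id * T) i j = (M * T) (σ i) j := fun i => by
    simp [Matrix.mul_apply]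
  simp only [h1, h2]
  exact (Equiv.sum_comp σ fun i => u i * (M * T) i j).symm

lemma kron2_lower_col_one {q : ℕ} (α : ZMod q) (i : Fin (2 * 2)) :
    kron2 (!![1, 0; α, 1] : Matrix (Fin 2) (Fin 2) (ZMod q)) i 1
      = if (i : ℕ) = 1 then 1 else if (i : ℕ) = 3 then α else 0 := by
  fin_cases i <;> simp [kron2, finProdFinEquiv, Fin.divNat, Fin.modNat]

lemma kron2_lower_col_two {q : ℕ} (α : ZMod q) (i : Fin (2 * 2)) :
    kron2 (!![1, 0; α, 1] : Matrix (Fin 2) (Fin 2) (ZMod q)) i 2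
      = if (i : ℕ) = 2 then 1 else if (i : ℕ) = 3 then α else 0 := by
  fin_cases i <;> simp [kron2, finProdFinEquiv, Fin.divNat, Fin.modNat]

lemma kron2_lower_col_three {q : ℕ} (α : ZMod q) (i : Fin (2 * 2)) :
    kron2 (!![1, 0; α, 1] : Matrix (Fin 2) (Fin 2) (ZMod q)) i 3
      = if (i : ℕ) = 3 then 1 else 0 := by
  fin_cases i <;> simp [kron2, finProdFinEquiv, Fin.divNat, Fin.modNat]

lemma exists_forall_sq_mul_log_le (K₁ K₂ ε : ℝ) (hε : 0 < ε) :
    ∃ τ : ℝ, 0 < τ ∧ τ ≤ 1 ∧ ∀ δ : ℝ, 0 < δ → δ < τ →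
      δ ^ 2 * (K₁ - K₂ * Real.log δ) ≤ δ ^ (2 - ε) := by
  have h1 : Filter.Tendsto (fun x : ℝ => x ^ ε) (nhdsWithin 0 (Set.Ioi 0)) (nhds 0) := by
    have := (Real.continuousAt_rpow_const 0 ε (Or.inr hε.le)).tendsto
    rw [Real.zero_rpow hε.ne'] at this
    exact this.mono_left nhdsWithin_le_nhds
  have h2 := (h1.const_mul K₁).sub ((tendsto_log_mul_rpow_nhdsGT_zero hε).const_mul K₂)
  rw [mul_zero, mul_zero, sub_zero] at h2
  have h3 := h2.eventually (gt_mem_nhds (zero_lt_one' ℝ))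
  rw [eventually_nhdsWithin_iff, Metric.eventually_nhds_iff] at h3
  obtain ⟨τ, hτ, H⟩ := h3
  refine ⟨min τ 1, lt_min hτ one_pos, min_le_right _ _, fun δ hδ hlt => ?_⟩
  have hb := H (y := δ) (by
    rw [Real.dist_eq, sub_zero, abs_of_pos hδ]; exact hlt.trans_le (min_le_left _ _)) hδ
  have hpos : 0 < δ ^ ε := Real.rpow_pos_of_pos hδ ε
  rw [Real.rpow_sub hδ, Real.rpow_two, le_div_iff₀ hpos, mul_assoc]
  have : (K₁ - K₂ * Real.log δ) * δ ^ ε ≤ 1 := by linarith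
  nlinarith [sq_nonneg δ]

/-- With at most one error among three coordinates, a repetition-type code decodes correctly;
so the decoding error is quadratic in the coordinate errors. -/
lemma exists_decoder {q k : ℕ} (hq : Nat.Prime q) {α : ZMod q} (hα : α ≠ 0)
    {M : Matrix (Fin k) (Fin k) (ZMod q)}
    {T : Matrix (Fin k) (Fin (2 * 2)) (ZMod q)} {σ : Equiv.Perm (Fin k)} {j₀ : Fin k} {β : ZMod q}
    (hβ : β ≠ 0)
    (hR : ∀ (i : Fin k) (j : Fin (2 * 2)), (M.submatrix σ id * T) i j =
      if h : (i : ℕ) < 2 * 2 then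
        kron2 (!![1, 0; α, 1] : Matrix (Fin 2) (Fin 2) (ZMod q)) ⟨(i : ℕ), h⟩ j else 0)
    (hT : ∀ i : Fin k, j₀ < i → ∀ j, T i j = 0)
    (hT₀ : ∀ j : Fin (2 * 2), T j₀ j = if (j : ℕ) = 2 * 2 - 1 then β else 0)
    {Ω Alph : Type} [Fintype Ω] {μ : Ω → ℝ} (hμ : ∀ ω, 0 ≤ μ ω)
    (U : Fin k → Ω → ZMod q) (A : Fin k → Ω → Alph) (g : Fin k → Alph → ZMod q)
    {c : ℝ} (hc : 0 ≤ c) (hpair : ∀ i j, i ≠ j →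
      pmfProb μ {ω | U i ω ≠ g i (A i ω) ∧ U j ω ≠ g j (A j ω)} ≤ c) :
    ∃ G : (Fin (j₀ : ℕ) → ZMod q) × (Fin k → Alph) → ZMod q,
      pmfProb μ {ω | Matrix.vecMul (fun i => U i ω) M j₀ ≠
        G (fun i : Fin (j₀ : ℕ) =>
          Matrix.vecMul (fun i' => U i' ω) M (Fin.castLE j₀.isLt.le i), fun i => A i ω)}
        ≤ 3 * c := by
  have : Fact q.Prime := ⟨hq⟩
  have hsum : ∀ (u : Fin k → ZMod q) (j : Fin (2 * 2)),
      ∑ l : Fin (j₀ : ℕ), Matrix.vecMul u M (Fin.castLE j₀.isLt.le l)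
          * T (Fin.castLE j₀.isLt.le l) j
        + Matrix.vecMul u M j₀ * (if (j : ℕ) = 3 then β else 0)
      = ∑ i, u (σ i) * (if h : (i : ℕ) < 2 * 2 then
        kron2 (!![1, 0; α, 1] : Matrix (Fin 2) (Fin 2) (ZMod q)) ⟨(i : ℕ), h⟩ j else 0) := by
    intro u j
    have h1 := sum_vecMul_mul M T σ u j
    rw [sum_eq_sum_castLE_add j₀ _ fun i hi => by rw [hT i hi j, mul_zero], hT₀] at h1
    simpa only [hR] using h1
  let C : (Fin (j₀ : ℕ) → ZMod q) → Fin (2 * 2) → ZMod q := fun v j =>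
    ∑ l, v l * T (Fin.castLE j₀.isLt.le l) j
  have hX : ∀ u : Fin k → ZMod q, ∀ w : ZMod q,
      C (fun l => Matrix.vecMul u M (Fin.castLE j₀.isLt.le l)) 3 + Matrix.vecMul u M j₀ * β = w →
      Matrix.vecMul u M j₀
        = (w - C (fun l => Matrix.vecMul u M (Fin.castLE j₀.isLt.le l)) 3) / β := by
    intro u w h
    rw [← h]
    field_simp
    ring
  by_cases hk : k < 4
  · refine ⟨fun y => (0 - C y.1 3) / β, ?_⟩
    have hempty : {ω | Matrix.vecMul (fun i => U i ω) M j₀ ≠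
        (0 - C (fun i : Fin (j₀ : ℕ) =>
          Matrix.vecMul (fun i' => U i' ω) M (Fin.castLE j₀.isLt.le i)) 3) / β} = ∅ := by
      refine Set.eq_empty_of_forall_notMem fun ω hω => hω (hX _ _ ?_)
      have h3 := hsum (fun i => U i ω) 3
      simp only [kron2_lower_col_three] at h3
      refine Eq.trans (by simpa using h3) (Finset.sum_eq_zero fun i _ => ?_)
      have : (i : ℕ) ≠ 3 := by omega
      simp [this]
    rw [hempty]
    simp [pmfProb]
    exact hc
  obtain ⟨n, rfl⟩ : ∃ n, k = 4 + n := Nat.exists_eq_add_of_le (not_lt.1 hk)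
  let i₁ : Fin (4 + n) := σ (Fin.castAdd n 1)
  let i₂ : Fin (4 + n) := σ (Fin.castAdd n 2)
  let i₃ : Fin (4 + n) := σ (Fin.castAdd n 3)
  have h12 : i₁ ≠ i₂ := fun h => by simpa [Fin.ext_iff] using σ.injective h
  have h13 : i₁ ≠ i₃ := fun h => by simpa [Fin.ext_iff] using σ.injective h
  have h23 : i₂ ≠ i₃ := fun h => by simpa [Fin.ext_iff] using σ.injective h
  have c1 : ∀ u : Fin (4 + n) → ZMod q,
      C (fun l => Matrix.vecMul u M (Fin.castLE j₀.isLt.le l)) 1 = u i₁ + u i₃ * α := by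
    intro u
    have h := hsum u 1
    simp only [kron2_lower_col_one, Fin.sum_univ_add, Fin.sum_univ_four] at h
    simpa using h
  have c2 : ∀ u : Fin (4 + n) → ZMod q,
      C (fun l => Matrix.vecMul u M (Fin.castLE j₀.isLt.le l)) 2 = u i₂ + u i₃ * α := by
    intro u
    have h := hsum u 2
    simp only [kron2_lower_col_two, Fin.sum_univ_add, Fin.sum_univ_four] at h
    simpa using h
  have c3 : ∀ u : Fin (4 + n) → ZMod q,
      C (fun l => Matrix.vecMul u M (Fin.castLE j₀.isLt.le l)) 3
        + Matrix.vecMul u M j₀ * β = u i₃ := by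
    intro u
    have h := hsum u 3
    simp only [kron2_lower_col_three, Fin.sum_univ_add, Fin.sum_univ_four] at h
    simpa using h
  let s : Fin (4 + n) → Fin (2 * 2) → (Fin (j₀ : ℕ) → ZMod q) × (Fin (4 + n) → Alph) → ZMod q :=
    fun i j y => C y.1 j - g i (y.2 i) - g i₃ (y.2 i₃) * α
  refine ⟨fun y => ((g i₃ (y.2 i₃) + if s i₁ 1 y ≠ 0 ∧ s i₂ 2 y ≠ 0 then s i₁ 1 y / α else 0)
    - C y.1 3) / β, ?_⟩
  have hsub : {ω | Matrix.vecMul (fun i => U i ω) M j₀ ≠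
      (fun y => ((g i₃ (y.2 i₃) + if s i₁ 1 y ≠ 0 ∧ s i₂ 2 y ≠ 0 then s i₁ 1 y / α else 0)
        - C y.1 3) / β) (fun i : Fin (j₀ : ℕ) =>
          Matrix.vecMul (fun i' => U i' ω) M (Fin.castLE j₀.isLt.le i), fun i => A i ω)} ⊆
      ({ω | U i₁ ω ≠ g i₁ (A i₁ ω) ∧ U i₂ ω ≠ g i₂ (A i₂ ω)} ∪
       {ω | U i₁ ω ≠ g i₁ (A i₁ ω) ∧ U i₃ ω ≠ g i₃ (A i₃ ω)}) ∪
       {ω | U i₂ ω ≠ g i₂ (A i₂ ω) ∧ U i₃ ω ≠ g i₃ (A i₃ ω)} := by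
    intro ω hω
    by_contra hno
    simp only [Set.mem_union, Set.mem_ofPred_eq, not_or, not_and_or, not_not] at hno
    refine hω (hX _ _ ?_)
    rw [c3]
    simp only [s, c1, c2]
    obtain ⟨⟨a, b⟩, d⟩ := hno
    generalize U i₁ ω = x₁ at *
    generalize U i₂ ω = x₂ at *
    generalize U i₃ ω = x₃ at *
    generalize g i₁ (A i₁ ω) = y₁ at *
    generalize g i₂ (A i₂ ω) = y₂ at *
    generalize g i₃ (A i₃ ω) = y₃ at *
    by_cases e3 : x₃ = y₃
    · subst e3
      rw [if_neg, add_zero]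
      rintro ⟨p1, p2⟩
      rcases a with a | a
      · exact p1 (by rw [a]; ring)
      · exact p2 (by rw [a]; ring)
    · have e1 : x₁ = y₁ := by tauto
      have e2 : x₂ = y₂ := by tauto
      subst e1 e2
      have hne : (x₃ - y₃) * α ≠ 0 := mul_ne_zero (sub_ne_zero.2 e3) hα
      rw [if_pos]
      · field_simp
        ring
      · constructor <;> (convert hne using 1; ring)
  refine (pmfProb_mono hμ hsub).trans ((pmfProb_union_le hμ _ _).trans ?_)
  have hu := pmfProb_union_le hμ {ω | U i₁ ω ≠ g i₁ (A i₁ ω) ∧ U i₂ ω ≠ g i₂ (A i₂ ω)}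
    {ω | U i₁ ω ≠ g i₁ (A i₁ ω) ∧ U i₃ ω ≠ g i₃ (A i₃ ω)}
  linarith [hpair i₁ i₂ h12, hpair i₁ i₃ h13, hpair i₂ i₃ h23]

lemma le_two_mul_mul_of_mul_le {x l B L : ℝ} (hl : 1 / 2 ≤ l) (hL : 1 ≤ L) (hB : 0 ≤ B)
    (h : x * l ≤ B) : x ≤ 2 * B * L := by
  have hx : x ≤ 2 * B := by
    by_cases h0 : 0 ≤ x <;> nlinarith
  nlinarith

/-- if `M ∈ 𝔽_q^{k×k}` usefully contains `([[1,0],[α,1]])⊗([[1,0],[α,1]])`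
for some nonzero `α`, then `M` satisfies `(1/k, 2-ε)`-exponential polarization
for every `ε > 0`. -/
theorem stmt9 (q : ℕ) [NeZero q] (hq : Nat.Prime q) {k : ℕ} (α : ZMod q) (hα : α ≠ 0)
    (M : Matrix (Fin k) (Fin k) (ZMod q))
    (h : UsefulContains (kron2 (!![1, 0; α, 1] : Matrix (Fin 2) (Fin 2) (ZMod q))) M)
    (ε : ℝ) (hε : 0 < ε) :
    ExpPolar q k M (1 / (k : ℝ)) (2 - ε) := by
  classical
  obtain ⟨T, σ, j₀, β, hβ, hR, hT, hT₀⟩ := h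
  have : Fact q.Prime := ⟨hq⟩
  have hq2 : (2 : ℝ) ≤ q := by exact_mod_cast hq.two_le
  set L : ℝ := Real.logb 2 q with hL
  have hL1 : 1 ≤ L := by
    rw [hL, Real.le_logb_iff_rpow_le (by norm_num) (by linarith)]
    simpa using hq2
  obtain ⟨τ, hτ, hτ1, Hτ⟩ :=
    exists_forall_sq_mul_log_le (2 * (3 * L ^ 2 + q)) (12 * L ^ 2) ε hε
  refine ⟨τ, hτ, ?_⟩
  intro δ hδ0 hδτ Ω Alph _ _ μ hμ hμ1 U A ⟨p, hp, hpj⟩ hent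
  have hest : ∀ i, ∃ g : Alph → ZMod q, pmfProb μ {ω | U i ω ≠ g (A i ω)} ≤ L * δ := by
    intro i
    obtain ⟨g, hg⟩ := exists_estimator hμ (U i) (A i)
    refine ⟨g, hg.trans ?_⟩
    have := hent i
    rw [nCondEnt, ← hL, div_le_iff₀ (by linarith)] at this
    linarith
  choose g hg using hest
  have hpair : ∀ i j, i ≠ j →
      pmfProb μ {ω | U i ω ≠ g i (A i ω) ∧ U j ω ≠ g j (A j ω)} ≤ (L * δ) ^ 2 := by
    intro i j hij
    have hind := pmfProb_inter_of_iid hμ1 (fun l ω => (U l ω, A l ω)) p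
      (fun l z => by simpa [Prod.ext_iff] using hp l z.1 z.2)
      (fun z => by simpa [Prod.ext_iff] using hpj (fun l => (z l).1) (fun l => (z l).2))
      (fun z => z.1 ≠ g i z.2) (fun z => z.1 ≠ g j z.2) hij
    simp only at hind
    rw [hind, sq]
    exact mul_le_mul (hg i) (hg j) (pmfProb_nonneg hμ _) ((pmfProb_nonneg hμ _).trans (hg i))
  obtain ⟨G, hG⟩ := exists_decoder hq hα hβ hR hT hT₀ hμ U A g (sq_nonneg (L * δ)) hpair
  have hk : (0 : ℝ) < k := by exact_mod_cast j₀.pos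
  rw [one_div, inv_mul_cancel₀ hk.ne', Nat.one_le_cast, Nat.one_le_iff_ne_zero,
    Finset.card_ne_zero]
  refine ⟨j₀, Finset.mem_filter.2 ⟨Finset.mem_univ _, ?_⟩⟩
  have hlog2 : 1 / 2 ≤ Real.log 2 := by linarith [Real.log_two_gt_d9]
  have hbound : ∀ r : ℝ, 0 < r → r ≤ 1 →
      nCondEnt q μ (fun ω => Matrix.vecMul (fun i => U i ω) M j₀)
          (fun ω => ((fun i : Fin (j₀ : ℕ) =>
              Matrix.vecMul (fun i' => U i' ω) M (Fin.castLE j₀.isLt.le i)),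
            (fun i => A i ω))) ≤
        2 * (3 * (L * δ) ^ 2 + r * q + 3 * (L * δ) ^ 2 * (-Real.log r)) := by
    intro r hr hr1
    have hfano := condEnt_mul_log_two_le hμ hμ1 (fun ω => Matrix.vecMul (fun i => U i ω) M j₀)
      (fun ω => ((fun i : Fin (j₀ : ℕ) =>
              Matrix.vecMul (fun i' => U i' ω) M (Fin.castLE j₀.isLt.le i)),
            (fun i => A i ω))) G hr
    have hlr : 0 ≤ -Real.log r := by linarith [Real.log_nonpos hr.le hr1]
    have hmul := mul_le_mul_of_nonneg_right hG hlr
    rw [ZMod.card] at hfano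
    have hB : 0 ≤ 3 * (L * δ) ^ 2 + r * q + 3 * (L * δ) ^ 2 * (-Real.log r) := by positivity
    rw [nCondEnt, ← hL, div_le_iff₀ (by linarith)]
    exact le_two_mul_mul_of_mul_le hlog2 hL1 hB (by linarith)
  rcases hδ0.eq_or_lt with rfl | hδ
  · refine le_trans ?_ (Real.rpow_nonneg le_rfl _)
    refine le_of_forall_pos_le_add fun η hη => ?_
    have hr : 0 < min 1 (η / (2 * q)) := lt_min one_pos (by positivity)
    refine (hbound _ hr (min_le_left _ _)).trans ?_
    have : min 1 (η / (2 * q)) * (2 * q) ≤ η :=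
      (le_div_iff₀ (by positivity)).1 (min_le_right _ _)
    simp
    linarith
  · refine (hbound (δ ^ 2) (by positivity) (by nlinarith)).trans (le_trans (le_of_eq ?_) (Hτ δ hδ hδτ))
    rw [Real.log_pow]
    push_cast
    ring
end

section
/- Let q be a prime power, P ∈ 𝔽_q^{k×s} a matrix, 0 < ε < 1/2, γ > 0, and Dec : 𝔽_q^s → 𝔽_q^k an arbitrary function. Let U = (U_1,…,U_k) have independent coordinates, each distributed according to B_q(ε). If ℙ(Dec(U·P) ≠ U) < exp(-k^γ), then every nonzero x ∈ 𝔽_q^k with x·P = 0 has Hamming weight wt(x) ≥ k^γ / log(q/ε); that is, ker P (as a set of row vectors) is a linear code of distance at least k^γ / log(q/ε). -/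
open scoped BigOperators

/-- The probability of an event determined by a finite-valued random variable `X` is the sum of the
point masses of the law of `X` over the event. -/
lemma pmfProb_preimage {Ω α : Type} [Fintype Ω] [Fintype α] (μ : Ω → ℝ) (X : Ω → α)
    (S : Set α) [DecidablePred (· ∈ S)] :
    pmfProb μ {ω | X ω ∈ S} = ∑ a, if a ∈ S then pmfProb μ {ω | X ω = a} else 0 := by
  classical
  unfold pmfProb
  have h : ∀ a, (if a ∈ S then ∑ ω, (if ω ∈ {ω | X ω = a} then μ ω else 0) else 0)
      = ∑ ω, if X ω = a then (if X ω ∈ S then μ ω else 0) else 0 := by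
    intro a
    split_ifs with ha
    · refine Finset.sum_congr rfl fun ω _ => ?_
      by_cases hω : X ω = a <;> simp [hω, ha]
    · refine (Finset.sum_eq_zero fun ω _ => ?_).symm
      by_cases hω : X ω = a <;> simp [hω, ha]
  rw [Finset.sum_congr rfl fun a _ => h a, Finset.sum_comm]
  simp only [Set.mem_ofPred_eq, Finset.sum_ite_eq, Finset.mem_univ, if_true]
  exact Finset.sum_congr rfl fun ω _ => by congr

/-- If a set `A` of total mass `1 - f` is disjoint from its translate by `x`, and translating by `x`
shrinks point masses by a factor at least `c`, then the complement has mass at least `c (1 - f)`. -/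
lemma mul_sum_le_sum_compl_of_translate {G : Type} [AddGroup G] [Fintype G] (p : G → ℝ)
    (hp : ∀ u, 0 ≤ p u) (A : Set G) [DecidablePred (· ∈ A)] (x : G)
    (hA : ∀ u ∈ A, u + x ∉ A) (c : ℝ) (hc : ∀ u, c * p u ≤ p (u + x)) :
    c * (∑ u, p u - ∑ u, if u ∈ Aᶜ then p u else 0) ≤ ∑ u, if u ∈ Aᶜ then p u else 0 := by
  rw [← Finset.sum_sub_distrib, Finset.mul_sum]
  rw [← Equiv.sum_comp (Equiv.addRight x) fun u => if u ∈ Aᶜ then p u else 0]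
  refine Finset.sum_le_sum fun u _ => ?_
  by_cases hu : u ∈ A
  · simpa [hu, hA u hu] using hc u
  · simp only [Set.mem_compl_iff, hu, not_false_eq_true, if_true, sub_self, mul_zero]
    split_ifs
    · exact le_rfl
    · exact hp _

/-- If every value of `g` lies in `[a, b]`, then translating by `x` shrinks the product weight by a
factor at least `a / b` for every nonzero coordinate of `x`. -/
lemma pow_mul_prod_le_prod_add {F : Type} [AddGroup F] [DecidableEq F] {k : ℕ} (g : F → ℝ)
    {a b : ℝ} (ha : 0 < a) (hag : ∀ t, a ≤ g t) (hgb : ∀ t, g t ≤ b) (x u : Fin k → F) :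
    (a / b) ^ ((Finset.univ : Finset (Fin k)).filter (fun i => x i ≠ 0)).card * ∏ i, g (u i)
      ≤ ∏ i, g ((u + x) i) := by
  have hb : 0 < b := ha.trans_le ((hag 0).trans (hgb 0))
  have hg : ∀ t, 0 ≤ g t := fun t => ha.le.trans (hag t)
  rw [← Finset.prod_const, Finset.prod_filter, ← Finset.prod_mul_distrib]
  refine Finset.prod_le_prod (fun i _ => ?_) fun i _ => ?_
  · exact mul_nonneg (by split_ifs <;> positivity) (hg _)
  · by_cases hx : x i = 0
    · simp [hx]
    · rw [if_pos hx]
      calc a / b * g (u i) ≤ a / b * b := by gcongr; exact hgb _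
        _ = a := by field_simp
        _ ≤ _ := hag _

/-- if `U ∈ 𝔽_q^k` has i.i.d. `B_q(ε)` coordinates and some decoder
recovers `U` from `U·P` with failure probability `< exp(-k^γ)`, then every nonzero
`x` with `x·P = 0` has Hamming weight at least `k^γ / log(q/ε)`. -/
theorem stmt12 (q : ℕ) (hq : ∃ p n : ℕ, p.Prime ∧ 0 < n ∧ q = p ^ n)
    (F : Type) [Field F] [Fintype F] [DecidableEq F] (hcard : Fintype.card F = q)
    {k s : ℕ} (P : Matrix (Fin k) (Fin s) F)
    (ε γ : ℝ) (hε0 : 0 < ε) (hε : ε < 1 / 2) (hγ : 0 < γ)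
    (Dec : (Fin s → F) → (Fin k → F))
    (Ω : Type) [Fintype Ω] (μ : Ω → ℝ) (hμ0 : ∀ ω, 0 ≤ μ ω) (hμ1 : ∑ ω : Ω, μ ω = 1)
    (U : Fin k → Ω → F)
    -- the coordinates of U are independent, each distributed according to B_q(ε)
    (hU : ∀ u : Fin k → F, pmfProb μ {ω | ∀ i, U i ω = u i}
        = ∏ i, (if u i = 0 then 1 - ε else ε / ((q : ℝ) - 1)))
    (hdec : pmfProb μ {ω | Dec (Matrix.vecMul (fun i => U i ω) P) ≠ fun i => U i ω}
        < Real.exp (-(k : ℝ) ^ γ)) :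
    ∀ x : Fin k → F, x ≠ 0 → Matrix.vecMul x P = 0 →
      (k : ℝ) ^ γ / Real.log ((q : ℝ) / ε) ≤
        ((Finset.univ : Finset (Fin k)).filter (fun i => x i ≠ 0)).card := by
  intro x hx hxP
  set w := ((Finset.univ : Finset (Fin k)).filter (fun i => x i ≠ 0)).card with hw
  have hw0 : w ≠ 0 := by
    rw [hw, Finset.card_ne_zero]
    obtain ⟨i, hi⟩ := Function.ne_iff.mp hx
    exact ⟨i, by simpa using hi⟩
  have hq2 : (2 : ℝ) ≤ q := by
    rw [← hcard]
    exact_mod_cast Fintype.one_lt_card (α := F)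
  set δ := ε / ((q : ℝ) - 1) with hδ
  have hδ0 : 0 < δ := div_pos hε0 (by linarith)
  have hδε : δ ≤ ε := div_le_self hε0.le (by linarith)
  have hδq : ε / q ≤ δ := by
    rw [hδ]
    gcongr
    · linarith
    · linarith
  have hτ : 0 < ε / q := by positivity
  let g : F → ℝ := fun t => if t = 0 then 1 - ε else δ
  have hag : ∀ t, δ ≤ g t := by intro t; simp only [g]; split_ifs <;> linarith
  have hgb : ∀ t, g t ≤ 1 - ε := by intro t; simp only [g]; split_ifs <;> linarith
  let X : Ω → Fin k → F := fun ω i => U i ω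
  let A : Set (Fin k → F) := {u | Dec (Matrix.vecMul u P) = u}
  classical
  have hX : ∀ u, pmfProb μ {ω | X ω = u} = ∏ i, g (u i) := by
    intro u
    rw [← hU u]
    simp only [X, funext_iff]
  have hf : pmfProb μ {ω | Dec (Matrix.vecMul (fun i => U i ω) P) ≠ fun i => U i ω}
      = ∑ u, if u ∈ Aᶜ then ∏ i, g (u i) else 0 := by
    simp only [← hX]
    exact pmfProb_preimage μ X Aᶜ
  have hsum : ∑ u : Fin k → F, ∏ i, g (u i) = 1 := by
    have h := pmfProb_preimage μ X Set.univ
    simp only [Set.mem_univ, if_true, hX] at h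
    rw [← h, ← hμ1]
    simp [pmfProb]
  have hA : ∀ u ∈ A, u + x ∉ A := by
    intro u hu hux
    simp only [A, Set.mem_ofPred_eq, Matrix.add_vecMul, hxP, add_zero] at hu hux
    exact hx (by simpa using hu.symm.trans hux)
  have key := mul_sum_le_sum_compl_of_translate (fun u : Fin k → F => ∏ i, g (u i))
    (fun u => Finset.prod_nonneg fun i _ => hδ0.le.trans (hag _)) A x hA _
    (pow_mul_prod_le_prod_add g hδ0 hag hgb x)
  rw [hsum, ← hf, ← hw] at key
  set f := pmfProb μ {ω | Dec (Matrix.vecMul (fun i => U i ω) P) ≠ fun i => U i ω}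
  set ρ := δ / (1 - ε) with hρ
  have hε1 : 0 < 1 - ε := by linarith
  have hρ0 : 0 < ρ := div_pos hδ0 hε1
  have hτρ : ε / q * (1 + ρ) ≤ ρ := by
    have h : 1 + ρ = (1 - ε + δ) / (1 - ε) := by rw [hρ]; field_simp
    rw [h, hρ, ← mul_div_assoc]
    gcongr
    nlinarith
  have hpow : (ε / q) ^ w * (1 + ρ ^ w) ≤ ρ ^ w := by
    calc (ε / q) ^ w * (1 + ρ ^ w) ≤ (ε / q) ^ w * (1 + ρ) ^ w := by
          gcongr
          simpa using pow_add_pow_le zero_le_one hρ0.le hw0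
      _ = (ε / q * (1 + ρ)) ^ w := (mul_pow _ _ _).symm
      _ ≤ ρ ^ w := by gcongr
  have hfτ : (ε / q) ^ w ≤ f := by
    have h1 : 0 < 1 + ρ ^ w := by positivity
    refine le_of_mul_le_mul_right (hpow.trans ?_) h1
    linarith
  have hlog : 0 < Real.log ((q : ℝ) / ε) :=
    Real.log_pos ((one_lt_div hε0).mpr (by linarith))
  have hlt := Real.log_lt_log (pow_pos hτ w) (hfτ.trans_lt hdec)
  rw [Real.log_exp, Real.log_pow, ← inv_div, Real.log_inv] at hlt
  rw [div_le_iff₀ hlog]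
  linarith
end

section
/- Let 𝔽_q be a finite field, P ∈ 𝔽_q^{k×s}, and define E = {x ∈ 𝔽_q^k : there exists h ∈ 𝔽_q^k with h·P = 0 and wt(x+h) < wt(x)}. Define the domination order on 𝔽_q^k by u ⪯ v if and only if u_i = v_i for every i in the support of u. Then E is upward closed under domination: if w₁ ∈ E and w₁ ⪯ w₂, then w₂ ∈ E. -/
open scoped BigOperators

/-- the set `E = {x : ∃ h, h·P = 0 ∧ wt(x+h) < wt(x)}` is upward closed
under the domination order (`u ⪯ v` iff `u_i = v_i` for all `i ∈ supp(u)`). -/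
theorem stmt13 (F : Type) [Field F] [Fintype F] [DecidableEq F]
    {k s : ℕ} (P : Matrix (Fin k) (Fin s) F)
    (w₁ w₂ : Fin k → F)
    (hw₁ : ∃ h : Fin k → F, Matrix.vecMul h P = 0 ∧
      ((Finset.univ : Finset (Fin k)).filter (fun i => w₁ i + h i ≠ 0)).card <
        ((Finset.univ : Finset (Fin k)).filter (fun i => w₁ i ≠ 0)).card)
    (hdom : ∀ i : Fin k, w₁ i ≠ 0 → w₁ i = w₂ i) :
    ∃ h : Fin k → F, Matrix.vecMul h P = 0 ∧
      ((Finset.univ : Finset (Fin k)).filter (fun i => w₂ i + h i ≠ 0)).card <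
        ((Finset.univ : Finset (Fin k)).filter (fun i => w₂ i ≠ 0)).card := by
  obtain ⟨h, hP, hlt⟩ := hw₁
  refine ⟨h, hP, ?_⟩
  simp only [Finset.card_filter] at hlt ⊢
  have key : ∑ i, ((if w₂ i + h i ≠ 0 then 1 else 0) + (if w₁ i ≠ 0 then 1 else 0)) ≤
      ∑ i, ((if w₁ i + h i ≠ 0 then 1 else 0) + (if w₂ i ≠ 0 then 1 else 0)) := by
    refine Finset.sum_le_sum fun i _ => ?_
    by_cases h₁ : w₁ i = 0
    · by_cases h₂ : w₂ i = 0
      · simp [h₁, h₂]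
      · simp only [h₁, h₂, ne_eq, not_true_eq_false, not_false_eq_true, if_true, if_false]
        split_ifs <;> omega
    · rw [hdom i h₁]
  rw [Finset.sum_add_distrib, Finset.sum_add_distrib] at key
  omega
end
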